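/- Let G be a countable discrete group and let H be a subgroup of G. Suppose that H is inner amenable and that the left translation action of G on the coset space G/H admits a G-invariant mean. Then G is inner amenable. -/

import Mathlib

open scoped Pointwise

/-- A mean on a set `Z`: a finitely additive probability measure defined on all subsets. -/
def IsMean {Z : Type*} (m : Set Z → ℝ) : Prop :=
  m Set.univ = 1 ∧ (∀ A : Set Z, 0 ≤ m A) ∧
    ∀ A B : Set Z, Disjoint A B → m (A ∪ B) = m A + m B

/-- A group is inner amenable if there is an atomless conjugation-invariant mean on it. -/
def InnerAmenable (G : Type*) [Group G] : Prop :=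
  ∃ m : Set G → ℝ, IsMean m ∧ (∀ A : Set G, A.Finite → m A = 0) ∧
    ∀ (g : G) (A : Set G), m ((fun h => g * h * g⁻¹) '' A) = m A

open Filter Topology

namespace IsMean

variable {X : Type*} {m : Set X → ℝ}

theorem empty (hm : IsMean m) : m ∅ = 0 := by
  have h := hm.2.2 ∅ ∅ (Set.disjoint_empty _)
  rw [Set.union_empty] at h
  linarith

theorem mono (hm : IsMean m) {A B : Set X} (h : A ⊆ B) : m A ≤ m B := by
  have := hm.2.2 A (B \ A) Set.disjoint_sdiff_right
  rw [Set.union_sdiff_cancel h] at this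
  linarith [hm.2.1 (B \ A)]

theorem le_one (hm : IsMean m) (A : Set X) : m A ≤ 1 :=
  hm.1 ▸ hm.mono (Set.subset_univ A)

theorem sum_fibers (hm : IsMean m) {ι : Type*} (φ : X → ι) (s : Finset ι) (A : Set X) :
    m {x | x ∈ A ∧ φ x ∈ s} = ∑ i ∈ s, m {x | x ∈ A ∧ φ x = i} := by
  classical
  induction s using Finset.induction_on with
  | empty => simp [hm.empty]
  | insert a s ha ih =>
    rw [Finset.sum_insert ha, ← ih, ← hm.2.2]
    · congr 1
      ext x
      simp only [Finset.mem_insert, Set.mem_ofPred_eq, Set.mem_union]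
      tauto
    · rw [Set.disjoint_left]
      rintro x ⟨_, rfl⟩ ⟨_, h⟩
      exact ha h

end IsMean

/-- The integral against `m` of a function with values in `{0, …, N - 1}`. -/
noncomputable def natIntegral {X : Type*} (m : Set X → ℝ) (N : ℕ) (u : X → ℕ) : ℝ :=
  ∑ k ∈ Finset.range N, (k : ℝ) * m {x | u x = k}

namespace IsMean

variable {X : Type*} {m : Set X → ℝ}

theorem natIntegral_comp (hm : IsMean m) {ι : Type*} (φ : X → ι) (s : Finset ι)
    (hφ : ∀ x, φ x ∈ s) (w : ι → ℕ) {N : ℕ} (hN : ∀ x, w (φ x) < N) :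
    natIntegral m N (fun x => w (φ x)) = ∑ i ∈ s, (w i : ℝ) * m {x | φ x = i} := by
  have h (k : ℕ) : m {x | w (φ x) = k} = ∑ i ∈ s, m {x | w (φ x) = k ∧ φ x = i} := by
    have := hm.sum_fibers φ s {x | w (φ x) = k}
    simpa [hφ] using this
  simp_rw [natIntegral, h, Finset.mul_sum]
  rw [Finset.sum_comm]
  refine Finset.sum_congr rfl fun i _ => ?_
  rw [Finset.sum_eq_single (w i)]
  · congr 2
    ext x
    simp only [Set.mem_ofPred_eq]
    exact ⟨And.right, fun h => ⟨h ▸ rfl, h⟩⟩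
  · intro k _ hk
    have : {x | w (φ x) = k ∧ φ x = i} = ∅ := by
      ext x
      simp only [Set.mem_ofPred_eq, Set.mem_empty_iff_false, iff_false]
      rintro ⟨h1, rfl⟩
      exact hk h1.symm
    rw [this, hm.empty, mul_zero]
  · intro hi
    have : {x | w (φ x) = w i ∧ φ x = i} = ∅ := by
      ext x
      simp only [Set.mem_ofPred_eq, Set.mem_empty_iff_false, iff_false]
      rintro ⟨_, rfl⟩
      exact hi (Finset.mem_range.2 (hN x))
    rw [this, hm.empty, mul_zero]

theorem natIntegral_add (hm : IsMean m) {N : ℕ} (u v : X → ℕ) (hN : ∀ x, u x + v x < N) :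
    natIntegral m N (fun x => u x + v x) = natIntegral m N u + natIntegral m N v := by
  have hu (x) : u x < N := by have := hN x; omega
  have hv (x) : v x < N := by have := hN x; omega
  have hs (x) : (u x, v x) ∈ Finset.range N ×ˢ Finset.range N := by simp [hu, hv]
  have h1 := hm.natIntegral_comp (fun x => (u x, v x)) _ hs (fun p => p.1 + p.2) hN
  have h2 := hm.natIntegral_comp (fun x => (u x, v x)) _ hs (fun p => p.1) hu
  have h3 := hm.natIntegral_comp (fun x => (u x, v x)) _ hs (fun p => p.2) hv
  simp only at h1 h2 h3
  rw [h1, h2, h3, ← Finset.sum_add_distrib]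
  refine Finset.sum_congr rfl fun p _ => ?_
  push_cast
  ring

theorem natIntegral_nonneg (hm : IsMean m) (N : ℕ) (u : X → ℕ) : 0 ≤ natIntegral m N u :=
  Finset.sum_nonneg fun _ _ => mul_nonneg (Nat.cast_nonneg _) (hm.2.1 _)

theorem natIntegral_const (hm : IsMean m) {N n : ℕ} (h : n < N) :
    natIntegral m N (fun _ => n) = n := by
  have := hm.natIntegral_comp (fun _ => ()) Finset.univ (by simp) (fun _ => n) (fun _ => h)
  simpa [hm.1] using this

theorem natIntegral_le (hm : IsMean m) {N n : ℕ} (u : X → ℕ) (hu : ∀ x, u x ≤ n) (h : n < N) :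
    natIntegral m N u ≤ n := by
  have h1 := hm.natIntegral_add (N := N) u (fun x => n - u x) (fun x => by have := hu x; omega)
  have h2 : (fun x => u x + (n - u x)) = fun _ => n := by
    ext x
    have := hu x
    omega
  rw [h2, hm.natIntegral_const h] at h1
  linarith [hm.natIntegral_nonneg N (fun x => n - u x)]

end IsMean

theorem floor_natCast_mul_le {n : ℕ} {a : ℝ} (h1 : a ≤ 1) : ⌊n * a⌋₊ ≤ n :=
  Nat.floor_le_of_le (mul_le_of_le_one_right (Nat.cast_nonneg n) h1)

/-- The integral against `m` of the rounding of `f` down to multiples of `1 / n`. -/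
noncomputable def roundedIntegral {X : Type*} (m : Set X → ℝ) (f : X → ℝ) (n : ℕ) : ℝ :=
  natIntegral m (n + 1) (fun x => ⌊n * f x⌋₊) / n

namespace IsMean

variable {X : Type*} {m : Set X → ℝ}

theorem roundedIntegral_mem_Icc (hm : IsMean m) {f : X → ℝ} (h1 : ∀ x, f x ≤ 1) (n : ℕ) :
    roundedIntegral m f n ∈ Set.Icc (0 : ℝ) 1 :=
  ⟨div_nonneg (hm.natIntegral_nonneg _ _) (Nat.cast_nonneg n),
    div_le_one_of_le₀ (hm.natIntegral_le _ (fun x => floor_natCast_mul_le (h1 x)) n.lt_succ_self)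
      (Nat.cast_nonneg n)⟩

theorem abs_roundedIntegral_add_sub_le (hm : IsMean m) {f g : X → ℝ} (hf : ∀ x, 0 ≤ f x)
    (hg : ∀ x, 0 ≤ g x) (h1 : ∀ x, f x + g x ≤ 1) {n : ℕ} (hn : 1 ≤ n) :
    |roundedIntegral m (fun x => f x + g x) n - (roundedIntegral m f n + roundedIntegral m g n)|
      ≤ 1 / n := by
  set u : X → ℕ := fun x => ⌊n * f x⌋₊ with hu
  set v : X → ℕ := fun x => ⌊n * g x⌋₊ with hv
  set w : X → ℕ := fun x => ⌊n * (f x + g x)⌋₊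
  have hn0 : (0 : ℝ) ≤ n := Nat.cast_nonneg n
  have huv (x) : u x + v x ≤ w x := by
    refine Nat.le_floor ?_
    push_cast
    linarith [Nat.floor_le (mul_nonneg hn0 (hf x)), Nat.floor_le (mul_nonneg hn0 (hg x))]
  have hwuv (x) : w x ≤ u x + v x + 1 := by
    refine Nat.lt_succ_iff.1 ((Nat.floor_lt (mul_nonneg hn0 (add_nonneg (hf x) (hg x)))).2 ?_)
    have h1 := Nat.lt_floor_add_one (n * f x)
    have h2 := Nat.lt_floor_add_one (n * g x)
    push_cast
    simp only [hu, hv]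
    linarith
  have hwn (x) : w x ≤ n := floor_natCast_mul_le (h1 x)
  have hsplit : (fun x => (u x + v x) + (w x - (u x + v x))) = w := by
    ext x
    have := huv x
    omega
  have e1 := hm.natIntegral_add (N := n + 1) (fun x => u x + v x) (fun x => w x - (u x + v x))
    (fun x => by have := huv x; have := hwn x; omega)
  rw [hsplit, hm.natIntegral_add u v (fun x => by have := huv x; have := hwn x; omega)] at e1
  have e2 := hm.natIntegral_le (N := n + 1) (n := 1) (fun x => w x - (u x + v x))
    (fun x => by have := hwuv x; omega) (by omega)
  have e3 := hm.natIntegral_nonneg (n + 1) (fun x => w x - (u x + v x))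
  simp only [roundedIntegral]
  rw [← add_div, ← sub_div, abs_div, abs_of_nonneg hn0]
  refine div_le_div_of_nonneg_right ?_ hn0
  rw [e1, add_sub_cancel_left, abs_of_nonneg e3]
  simpa using e2

/-- Integration of `[0, 1]`-valued functions against a mean. -/
theorem exists_integral (hm : IsMean m) : ∃ I : (X → ℝ) → ℝ,
    I (fun _ => 1) = 1 ∧ (∀ f, (∀ x, f x ≤ 1) → 0 ≤ I f) ∧
    (∀ f g, (∀ x, 0 ≤ f x) → (∀ x, 0 ≤ g x) → (∀ x, f x + g x ≤ 1) →
      I (fun x => f x + g x) = I f + I g) ∧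
    ∀ σ : X → X, (∀ A, m (σ ⁻¹' A) = m A) → ∀ f, I (fun x => f (σ x)) = I f := by
  let U : Ultrafilter ℕ := hyperfilter ℕ
  have hU : (U : Filter ℕ) ≤ atTop := Nat.hyperfilter_le_atTop
  have lim (f : X → ℝ) (h1 : ∀ x, f x ≤ 1) : ∃ a ∈ Set.Icc (0 : ℝ) 1,
      Tendsto (roundedIntegral m f) U (𝓝 a) := by
    have := isCompact_Icc.ultrafilter_le_nhds (U.map (roundedIntegral m f))
      (tendsto_principal.2 (Eventually.of_forall (hm.roundedIntegral_mem_Icc h1)))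
    exact this
  refine ⟨fun f => limUnder (U : Filter ℕ) (roundedIntegral m f), ?_, ?_, ?_, ?_⟩
  · refine Tendsto.limUnder_eq (tendsto_const_nhds.congr' ?_)
    filter_upwards [hU (eventually_ge_atTop 1)] with n hn
    have : (n : ℝ) ≠ 0 := by positivity
    simp [roundedIntegral, hm.natIntegral_const n.lt_succ_self, this]
  · intro f h1
    obtain ⟨a, ha, hl⟩ := lim f h1
    simpa only [hl.limUnder_eq] using ha.1
  · intro f g hf hg h1
    obtain ⟨a, -, ha⟩ := lim f fun x => by linarith [hg x, h1 x]
    obtain ⟨b, -, hb⟩ := lim g fun x => by linarith [hf x, h1 x]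
    obtain ⟨c, -, hc⟩ := lim _ h1
    simp only [ha.limUnder_eq, hb.limUnder_eq, hc.limUnder_eq]
    have h0 : Tendsto (fun n : ℕ => roundedIntegral m (fun x => f x + g x) n -
        (roundedIntegral m f n + roundedIntegral m g n)) U (𝓝 0) := by
      refine squeeze_zero_norm' ?_ (tendsto_one_div_atTop_nhds_zero_nat.mono_left hU)
      filter_upwards [hU (eventually_ge_atTop 1)] with n hn
      exact hm.abs_roundedIntegral_add_sub_le hf hg h1 hn
    exact sub_eq_zero.1 (tendsto_nhds_unique (hc.sub (ha.add hb)) h0)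
  · intro σ hσ f
    have : roundedIntegral m (fun x => f (σ x)) = roundedIntegral m f := by
      ext n
      simp only [roundedIntegral, natIntegral]
      congr 1
      refine Finset.sum_congr rfl fun k _ => ?_
      rw [← hσ {x | ⌊n * f x⌋₊ = k}]
      rfl
    simp only [this]

end IsMean

section CosetMeasure

variable {G : Type*} [Group G] {H : Subgroup G}

/-- The measure of `A ⊆ G` under the mean carried from `H` to `x H x⁻¹` by conjugation by a
representative `x` of the coset `c`. -/
noncomputable def cosetMeasure (ν : Set H → ℝ) (A : Set G) (c : G ⧸ H) : ℝ :=
  ν {h | c.out * h * c.out⁻¹ ∈ A}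

theorem cosetMeasure_mk {ν : Set H → ℝ}
    (hν : ∀ (g : H) (A : Set H), ν ((fun h => g * h * g⁻¹) '' A) = ν A) (A : Set G) (x : G) :
    cosetMeasure ν A (x : G ⧸ H) = ν {h | x * h * x⁻¹ ∈ A} := by
  obtain ⟨k, hk⟩ := QuotientGroup.mk_out_eq_mul H x
  rw [cosetMeasure, hk, ← hν k]
  congr 1
  ext h
  simp only [Set.mem_image, Set.mem_ofPred_eq]
  constructor
  · rintro ⟨j, hj, rfl⟩
    simpa [mul_assoc] using hj
  · intro hh
    exact ⟨k⁻¹ * h * k, by simpa [mul_assoc] using hh, by group⟩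

theorem cosetMeasure_conj {ν : Set H → ℝ}
    (hν : ∀ (g : H) (A : Set H), ν ((fun h => g * h * g⁻¹) '' A) = ν A) (A : Set G) (g : G)
    (c : G ⧸ H) :
    cosetMeasure ν ((fun h => g * h * g⁻¹) '' A) c = cosetMeasure ν A (g⁻¹ • c) := by
  induction c using QuotientGroup.induction_on with
  | H x =>
    rw [show g⁻¹ • (x : G ⧸ H) = ((g⁻¹ * x : G) : G ⧸ H) from rfl, cosetMeasure_mk hν,
      cosetMeasure_mk hν]
    congr 1
    ext h
    simp only [Set.mem_image, Set.mem_ofPred_eq]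
    constructor
    · rintro ⟨a, ha, e⟩
      have : g⁻¹ * x * h * (g⁻¹ * x)⁻¹ = a := by
        rw [show g⁻¹ * x * h * (g⁻¹ * x)⁻¹ = g⁻¹ * (x * h * x⁻¹) * g by group, ← e]
        group
      rwa [this]
    · intro hh
      exact ⟨_, hh, by group⟩

end CosetMeasure

/-- If `H ≤ G` is inner amenable and the translation action of `G` on `G/H` admits an
invariant mean, then `G` is inner amenable. -/
theorem stmt12 {G : Type*} [Group G] [Countable G] (H : Subgroup G)
    (hH : InnerAmenable H)
    (hmean : ∃ m : Set (G ⧸ H) → ℝ, IsMean m ∧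
      ∀ (g : G) (A : Set (G ⧸ H)), m (g • A) = m A) :
    InnerAmenable G := by
  obtain ⟨ν, hν, hfin, hconj⟩ := hH
  obtain ⟨m, hm, hinv⟩ := hmean
  obtain ⟨I, I_one, I_nonneg, I_add, I_inv⟩ := hm.exists_integral
  have add (A B : Set G) (h : Disjoint A B) : cosetMeasure ν (A ∪ B) =
      fun c : G ⧸ H => cosetMeasure ν A c + cosetMeasure ν B c := by
    ext c
    exact hν.2.2 _ _ (h.preimage fun h : H => c.out * h * c.out⁻¹)
  refine ⟨fun A => I (cosetMeasure ν A), ⟨?_, ?_, ?_⟩, ?_, ?_⟩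
  · have h1 : cosetMeasure ν Set.univ = fun _ : G ⧸ H => (1 : ℝ) := by
      ext c
      simp [cosetMeasure, hν.1]
    simp only [h1, I_one]
  · exact fun A => I_nonneg _ fun c => hν.le_one _
  · intro A B h
    simp only [add A B h]
    refine I_add _ _ (fun c => hν.2.1 _) (fun c => hν.2.1 _) fun c => ?_
    rw [← congrFun (add A B h) c]
    exact hν.le_one _
  · intro A hA
    have h0 : cosetMeasure ν A = fun _ : G ⧸ H => (0 : ℝ) := by
      ext c
      refine hfin _ (hA.preimage (f := fun h : H => c.out * h * c.out⁻¹) ?_)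
      intro a _ b _ h
      simpa using h
    have := I_add (fun _ => 0) (fun _ => 0) (by simp) (by simp) (by simp)
    simp only [add_zero] at this
    simp only [h0]
    linarith
  · intro g A
    simp only [funext (cosetMeasure_conj hconj A g)]
    refine I_inv (fun c => g⁻¹ • c) (fun B => ?_) _
    rw [Set.preimage_smul_inv, hinv]
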